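/- Fix d ≥ 2 and suppose G has at least one vertex of degree d. Let w_1, …, w_k be independent wedges, each generated by choosing a vertex uniformly at random from the set V_d of degree-d vertices and then choosing a uniformly random unordered pair of its distinct neighbors. For each i let Y_i = 0 if w_i is open, Y_i = 1/3 if w_i is closed with 3 triangle vertices in V_d, Y_i = 1/2 if w_i is closed with exactly 2 triangle vertices in V_d, and Y_i = 1 if w_i is closed with exactly 1 triangle vertex in V_d; let Ȳ = (1/k) Σ_{i=1}^k Y_i. If ε ∈ (0,1), δ ∈ (0,1), and k = ⌈0.5 ε^{-2} ln(2/δ)⌉, then |W_d · Ȳ − T_d| < ε W_d with probability greater than 1 − δ, where W_d = n_d · binom(d,2) and T_d is the number of triangles containing at least one degree-d vertex. -/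

import Mathlib

open MeasureTheory
open scoped ENNReal

/-- The set of wedges of a simple graph `G`: pairs `(v, {u, u'})` where `u` and `u'`
are distinct neighbors of the center vertex `v`. -/
def SimpleGraph.wedgeSet {V : Type*} (G : SimpleGraph V) : Set (V × Sym2 V) :=
  {w | ¬ w.2.IsDiag ∧ ∀ u ∈ w.2, G.Adj w.1 u}

/-- A wedge `(v, {u, u'})` is closed when its endpoints `u` and `u'` are adjacent. -/
def SimpleGraph.WedgeClosed {V : Type*} (G : SimpleGraph V) (w : V × Sym2 V) : Prop :=
  w.2 ∈ G.edgeSet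

instance {V : Type*} (G : SimpleGraph V) [DecidableRel G.Adj] :
    DecidablePred G.WedgeClosed :=
  fun w => inferInstanceAs (Decidable (w.2 ∈ G.edgeSet))

/-- The unordered pair `{u, u'}` as a finset. -/
def Sym2.pairFinset {V : Type*} [DecidableEq V] (p : Sym2 V) : Finset V :=
  Sym2.lift ⟨fun u u' => ({u, u'} : Finset V), fun u u' => Finset.pair_comm u u'⟩ p

/-- The three vertices of a wedge `(v, {u, u'})`, i.e. `{v, u, u'}`; for a closed wedge
this is its associated triangle. -/
def wedgeTri {V : Type*} [DecidableEq V] (w : V × Sym2 V) : Finset V :=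
  insert w.1 w.2.pairFinset

/-- `V_d`: the finset of vertices of `G` of degree `d`. -/
def SimpleGraph.degVerts {V : Type*} [Fintype V] (G : SimpleGraph V)
    [DecidableRel G.Adj] (d : ℕ) : Finset V :=
  Finset.univ.filter (fun v => G.degree v = d)

/-- The random variable `Y` of the `T_d`-wedge sampler: `Y = 0` if the wedge is open;
`Y = 1/3` if it is closed and its triangle has 3 vertices of degree `d`; `Y = 1/2` if it
is closed and its triangle has exactly 2 vertices of degree `d`; `Y = 1` if it is closed
and its triangle has exactly 1 vertex of degree `d`. -/
noncomputable def Yfun {V : Type*} [Fintype V] [DecidableEq V] (G : SimpleGraph V)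
    [DecidableRel G.Adj] (d : ℕ) (w : V × Sym2 V) : ℝ :=
  if ¬ G.WedgeClosed w then 0
  else if ((wedgeTri w).filter (fun x => G.degree x = d)).card = 3 then 1 / 3
  else if ((wedgeTri w).filter (fun x => G.degree x = d)).card = 2 then 1 / 2
  else if ((wedgeTri w).filter (fun x => G.degree x = d)).card = 1 then 1
  else 0

open ProbabilityTheory in
/-- Strict sub-Gaussian tail bound for a centered random variable. -/
lemma strict_tail {Ω : Type*} [MeasurableSpace Ω] {μ : Measure Ω} [IsProbabilityMeasure μ]
    {X : Ω → ℝ} {c : NNReal} (h : HasSubgaussianMGF X c μ) (hc : 0 < c) (h0 : ∫ ω, X ω ∂μ = 0)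
    {a : ℝ} (ha : 0 < a) : μ {ω | a ≤ X ω} < ENNReal.ofReal (Real.exp (-a ^ 2 / (2 * c))) := by
  have hc' : (0 : ℝ) < c := by exact_mod_cast hc
  have hXi := h.integrable
  have hXm : AEMeasurable X μ := hXi.aemeasurable
  set S := {ω | a ≤ X ω} with hS
  have hSm : NullMeasurableSet S μ := nullMeasurableSet_le aemeasurable_const hXm
  set t : ℝ := a / c with ht
  have htpos : 0 < t := by positivity
  have hint := h.integrable_exp_mul t
  have hmgf := h.mgf_le t
  have hind : Integrable (S.indicator (fun _ => Real.exp (t * a))) μ :=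
    (integrable_const _).indicator₀ hSm
  have hle : ∀ ω, S.indicator (fun _ => Real.exp (t * a)) ω ≤ Real.exp (t * X ω) := by
    intro ω
    by_cases hω : ω ∈ S
    · rw [Set.indicator_of_mem hω]
      exact Real.exp_le_exp.2 (mul_le_mul_of_nonneg_left hω htpos.le)
    · rw [Set.indicator_of_notMem hω]
      positivity
  have hval : ∫ ω, S.indicator (fun _ => Real.exp (t * a)) ω ∂μ = μ.real S * Real.exp (t * a) := by
    rw [integral_indicator₀ hSm]
    simp
  have hlt : μ.real S * Real.exp (t * a) < ∫ ω, Real.exp (t * X ω) ∂μ := by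
    rw [← hval]
    refine lt_of_le_of_ne (integral_mono hind hint hle) ?_
    intro heq
    have := (integral_eq_iff_of_ae_le hind hint (Filter.Eventually.of_forall hle)).1 heq
    have hX : X =ᵐ[μ] fun _ => a := by
      filter_upwards [this] with ω hω
      by_cases hωS : ω ∈ S
      · rw [Set.indicator_of_mem hωS] at hω
        have := Real.exp_injective hω
        exact (mul_left_cancel₀ htpos.ne' this).symm
      · rw [Set.indicator_of_notMem hωS] at hω
        exact absurd hω (Real.exp_pos _).ne
    rw [integral_congr_ae hX] at h0
    simp at h0
    exact ha.ne' h0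
  have h2 : μ.real S * Real.exp (t * a) < Real.exp (c * t ^ 2 / 2) := lt_of_lt_of_le hlt hmgf
  have h3 : μ.real S < Real.exp (-a ^ 2 / (2 * c)) := by
    rw [← lt_div_iff₀ (Real.exp_pos _), ← Real.exp_sub] at h2
    have e : c * t ^ 2 / 2 - t * a = -a ^ 2 / (2 * c) := by
      rw [ht]
      field_simp
      ring
    rwa [e] at h2
  rw [← ofReal_measureReal]
  exact (ENNReal.ofReal_lt_ofReal_iff (Real.exp_pos _)).2 h3

/-- A map into a finite set whose fibers have outer measures summing to one is a.e. measurable. -/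
lemma aemeasurable_of_fibers {Ω : Type*} [MeasurableSpace Ω] {μ : Measure Ω}
    [IsProbabilityMeasure μ] {α : Type*} [Fintype α] [MeasurableSpace α]
    [MeasurableSingletonClass α]
    (w : Ω → α) (hw : ∑ x, μ (w ⁻¹' {x}) ≤ 1) : AEMeasurable w μ := by
  classical
  have key : ∀ x, NullMeasurableSet (w ⁻¹' {x}) μ := by
    intro x
    set A := w ⁻¹' {x} with hA
    have h1 : μ A + μ Aᶜ ≤ 1 := by
      refine le_trans ?_ hw
      rw [← Finset.add_sum_erase _ _ (Finset.mem_univ x)]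
      gcongr
      have : Aᶜ ⊆ ⋃ y ∈ Finset.univ.erase x, w ⁻¹' {y} := by
        intro ω hω
        simp only [Set.mem_iUnion]
        exact ⟨w ω, by simpa [hA] using hω, rfl⟩
      exact (measure_mono this).trans (measure_biUnion_finset_le _ _)
    have hB := measurableSet_toMeasurable μ A
    have hC := measurableSet_toMeasurable μ Aᶜ
    have hun : toMeasurable μ A ∪ toMeasurable μ Aᶜ = Set.univ := by
      rw [Set.eq_univ_iff_forall]
      intro ω
      by_cases h : ω ∈ A
      · exact Or.inl (subset_toMeasurable _ _ h)
      · exact Or.inr (subset_toMeasurable μ Aᶜ h)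
    have h2 := measure_union_add_inter (μ := μ) (toMeasurable μ A) hC
    rw [hun, measure_univ, measure_toMeasurable, measure_toMeasurable] at h2
    have h3 : μ (toMeasurable μ A ∩ toMeasurable μ Aᶜ) = 0 := by
      have h4 : 1 + μ (toMeasurable μ A ∩ toMeasurable μ Aᶜ) ≤ 1 + 0 := by
        rw [h2]; simpa using h1
      exact le_antisymm ((ENNReal.add_le_add_iff_left ENNReal.one_ne_top).1 h4) zero_le
    have h5 : μ (toMeasurable μ A \ A) = 0 :=
      measure_mono_null (Set.inter_subset_inter_right _ (subset_toMeasurable μ Aᶜ)) h3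
    have h6 : A = toMeasurable μ A \ (toMeasurable μ A \ A) := by
      rw [Set.sdiff_sdiff_cancel_left (subset_toMeasurable _ _)]
    rw [h6]
    exact hB.nullMeasurableSet.diff (NullMeasurableSet.of_null h5)
  refine NullMeasurable.aemeasurable ?_
  intro s _
  have : w ⁻¹' s = ⋃ x ∈ s, w ⁻¹' {x} := by ext; simp
  rw [this]
  exact NullMeasurableSet.biUnion s.to_countable (fun x _ => key x)

open ProbabilityTheory in
lemma uniform_sampler {α : Type*} [Fintype α] [DecidableEq α] (L : Finset α) (hL : L.Nonempty)
    (f : α → ℝ) (hf : ∀ x, f x ∈ Set.Icc (0 : ℝ) 1)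
    {Ω : Type*} [MeasurableSpace Ω] (μ : Measure Ω) [IsProbabilityMeasure μ]
    (ε δ : ℝ) (hε : ε ∈ Set.Ioo (0 : ℝ) 1) (hδ : δ ∈ Set.Ioo (0 : ℝ) 1)
    (k : ℕ) (hk : k = ⌈0.5 / ε ^ 2 * Real.log (2 / δ)⌉₊)
    (w : Fin k → Ω → α)
    (hindep : ∀ (s : Fin k → α),
        μ (⋂ i, w i ⁻¹' {s i}) = ∏ i, μ (w i ⁻¹' {s i}))
    (hdist : ∀ i, ∀ x ∈ L, μ (w i ⁻¹' {x}) = (L.card : ℝ≥0∞)⁻¹)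
    (hsupp : ∀ i, ∀ x ∉ L, μ (w i ⁻¹' {x}) = 0) :
    ENNReal.ofReal (1 - δ) <
      μ {ω | |((k : ℝ)⁻¹ * ∑ i, f (w i ω)) - (∑ x ∈ L, f x) / L.card| < ε} := by
  let _ : MeasurableSpace α := ⊤
  have : MeasurableSingletonClass α := ⟨fun _ => trivial⟩
  obtain ⟨hε0, hε1⟩ := hε
  obtain ⟨hδ0, hδ1⟩ := hδ
  have hcard : (0 : ℝ) < L.card := by exact_mod_cast hL.card_pos
  have hlog : 0 < Real.log (2 / δ) := Real.log_pos (by rw [lt_div_iff₀ hδ0]; linarith)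
  have hkle : 0.5 / ε ^ 2 * Real.log (2 / δ) ≤ k := by rw [hk]; exact Nat.le_ceil _
  have hkpos : (0 : ℝ) < k := lt_of_lt_of_le (by positivity) hkle
  have hm : ∀ i, AEMeasurable (w i) μ := by
    intro i
    apply aemeasurable_of_fibers
    have : ∑ x, μ (w i ⁻¹' {x}) = ∑ x ∈ L, (L.card : ℝ≥0∞)⁻¹ := by
      rw [← Finset.sum_subset (Finset.subset_univ L) (fun x _ hx => hsupp i x hx)]
      exact Finset.sum_congr rfl (hdist i)
    rw [this, Finset.sum_const, nsmul_eq_mul]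
    exact ENNReal.mul_inv_le_one _
  have hI : iIndepFun w μ := by
    rw [iIndepFun_iff_map_fun_eq_pi_map hm]
    have : ∀ i, IsProbabilityMeasure (μ.map (w i)) :=
      fun i => Measure.isProbabilityMeasure_map (hm i)
    refine Measure.ext_of_singleton fun s => ?_
    rw [Measure.pi_singleton, Measure.map_apply_of_aemeasurable (aemeasurable_pi_iff.2 hm)
      (measurableSet_singleton s)]
    simp_rw [fun i => Measure.map_apply_of_aemeasurable (hm i) (measurableSet_singleton (s i))]
    rw [← hindep]
    congr 1
    ext ω
    simp [funext_iff]
  have hfm : Measurable f := fun _ _ => trivial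
  set m : ℝ := (∑ x ∈ L, f x) / L.card with hmdef
  have hmean : ∀ i, ∫ ω, f (w i ω) ∂μ = m := by
    intro i
    have : IsProbabilityMeasure (μ.map (w i)) := Measure.isProbabilityMeasure_map (hm i)
    rw [← integral_map (hm i) hfm.aestronglyMeasurable,
      integral_fintype (Integrable.of_finite)]
    have hr : ∀ x, (μ.map (w i)).real {x} = (μ (w i ⁻¹' {x})).toReal := by
      intro x
      rw [Measure.real, Measure.map_apply_of_aemeasurable (hm i) (measurableSet_singleton x)]
    simp_rw [hr]
    rw [← Finset.sum_subset (Finset.subset_univ L) (fun x _ hx => by simp [hsupp i x hx]),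
      Finset.sum_congr rfl (fun x hx => by rw [hdist i x hx])]
    simp [← Finset.mul_sum, hmdef, div_eq_inv_mul]
  have hsub : ∀ i, HasSubgaussianMGF (fun ω => f (w i ω) - m) ((1 / 2) ^ 2) μ := by
    intro i
    have := hasSubgaussianMGF_of_mem_Icc (μ := μ) (X := fun ω => f (w i ω)) (a := 0) (b := 1)
      (hfm.comp_aemeasurable (hm i)) (Filter.Eventually.of_forall fun ω => hf _)
    rw [hmean i] at this
    simpa using this
  have hI2 : iIndepFun (fun i ω => f (w i ω) - m) μ :=
    hI.comp (fun _ x => f x - m) (fun _ _ _ => trivial)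
  set S : Ω → ℝ := fun ω => ∑ i, (f (w i ω) - m) with hS
  have hSub : HasSubgaussianMGF S (∑ i : Fin k, (1 / 2) ^ 2) μ :=
    HasSubgaussianMGF.sum_of_iIndepFun hI2 (s := Finset.univ) (fun i _ => hsub i)
  have hS0 : ∫ ω, S ω ∂μ = 0 := by
    rw [hS, integral_finsetSum _ (fun i _ => (hsub i).integrable)]
    refine Finset.sum_eq_zero fun i _ => ?_
    have hi : Integrable (fun ω => f (w i ω)) μ := by
      have h := (hsub i).integrable.add (integrable_const m)
      refine h.congr (Filter.Eventually.of_forall fun ω => ?_)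
      simp
    rw [integral_sub hi (integrable_const _), hmean i]
    simp
  have hcval : ((∑ i : Fin k, (1 / 2) ^ 2 : NNReal) : ℝ) = k / 4 := by
    push_cast
    simp
    ring
  have hcpos : 0 < (∑ i : Fin k, (1 / 2) ^ 2 : NNReal) := by
    rw [← NNReal.coe_pos, hcval]; positivity
  have ha : 0 < k * ε := by positivity
  have t1 := strict_tail hSub hcpos hS0 ha
  have t2 := strict_tail hSub.neg hcpos (by simp [integral_neg, hS0]) ha
  rw [hcval] at t1 t2
  have hexp : Real.exp (-(k * ε) ^ 2 / (2 * (k / 4))) ≤ δ / 2 := by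
    rw [← Real.le_log_iff_exp_le (by positivity)]
    have e1 : -(k * ε) ^ 2 / (2 * ((k : ℝ) / 4)) = - (2 * k * ε ^ 2) := by
      field_simp
      ring
    have e2 : Real.log (δ / 2) = - Real.log (2 / δ) := by
      rw [← Real.log_inv, inv_div]
    rw [e1, e2]
    have : 0.5 / ε ^ 2 * Real.log (2 / δ) * (2 * ε ^ 2) ≤ k * (2 * ε ^ 2) := by gcongr
    have e3 : 0.5 / ε ^ 2 * Real.log (2 / δ) * (2 * ε ^ 2) = Real.log (2 / δ) := by
      field_simp
      norm_num
    linarith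
  set A := {ω | |((k : ℝ)⁻¹ * ∑ i, f (w i ω)) - m| < ε} with hA
  have hAc : Aᶜ ⊆ {ω | k * ε ≤ S ω} ∪ {ω | k * ε ≤ (-S) ω} := by
    intro ω hω
    have h1 : ε ≤ |((k : ℝ)⁻¹ * ∑ i, f (w i ω)) - m| := by simpa [hA] using hω
    have h2 : S ω = k * (((k : ℝ)⁻¹ * ∑ i, f (w i ω)) - m) := by
      simp only [hS, Finset.sum_sub_distrib, Finset.sum_const, Finset.card_univ, Fintype.card_fin,
        nsmul_eq_mul]
      field_simp
    have h3 : k * ε ≤ |S ω| := by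
      rw [h2, abs_mul, abs_of_pos hkpos]
      gcongr
    exact le_abs.1 h3
  have hlt : μ Aᶜ < ENNReal.ofReal δ := by
    calc μ Aᶜ ≤ _ := measure_mono hAc
      _ ≤ _ := measure_union_le _ _
      _ < _ := ENNReal.add_lt_add t1 t2
      _ ≤ ENNReal.ofReal (δ / 2) + ENNReal.ofReal (δ / 2) := by gcongr
      _ = ENNReal.ofReal δ := by
        rw [← ENNReal.ofReal_add (by positivity) (by positivity)]; congr 1; ring
  have huniv : 1 ≤ μ A + μ Aᶜ := by
    rw [← measure_univ (μ := μ), ← Set.union_compl_self A]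
    exact measure_union_le _ _
  by_contra hcon
  rw [not_lt] at hcon
  have : μ A + μ Aᶜ < ENNReal.ofReal (1 - δ) + ENNReal.ofReal δ :=
    ENNReal.add_lt_add_of_le_of_lt (measure_ne_top _ _) hcon hlt
  rw [← ENNReal.ofReal_add (by linarith) hδ0.le] at this
  simp at this
  exact absurd huniv (not_le.2 this)

lemma mem_pairFinset_iff {V : Type*} [DecidableEq V] (p : Sym2 V) (x : V) :
    x ∈ p.pairFinset ↔ x ∈ p := by
  induction p using Sym2.ind with
  | _ a b => simp [Sym2.pairFinset]

lemma mem_wedgeTri_iff {V : Type*} [DecidableEq V] (q : V × Sym2 V) (x : V) :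
    x ∈ wedgeTri q ↔ x = q.1 ∨ x ∈ q.2 := by
  simp [wedgeTri, mem_pairFinset_iff]

open Classical in
/-- Wedges centered at degree `d` vertices. -/
noncomputable def wedgesAt {V : Type*} [Fintype V] (G : SimpleGraph V)
    [DecidableRel G.Adj] (d : ℕ) : Finset (V × Sym2 V) :=
  Finset.univ.filter (fun x => x ∈ G.wedgeSet ∧ G.degree x.1 = d)

lemma mem_wedgesAt {V : Type*} [Fintype V] (G : SimpleGraph V)
    [DecidableRel G.Adj] (d : ℕ) (x : V × Sym2 V) :
    x ∈ wedgesAt G d ↔ x ∈ G.wedgeSet ∧ G.degree x.1 = d := by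
  simp [wedgesAt]

lemma card_wedgesAt {V : Type*} [Fintype V] [DecidableEq V] (G : SimpleGraph V)
    [DecidableRel G.Adj] (d : ℕ) :
    (wedgesAt G d).card = (G.degVerts d).card * d.choose 2 := by
  have hmaps : ∀ x ∈ wedgesAt G d, x.1 ∈ G.degVerts d := by
    intro x hx
    simpa [SimpleGraph.degVerts] using ((mem_wedgesAt G d x).1 hx).2
  rw [Finset.card_eq_sum_card_fiberwise hmaps]
  rw [Finset.sum_const_nat (m := d.choose 2)]
  intro v hv
  have hv' : G.degree v = d := by simpa [SimpleGraph.degVerts] using hv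
  have h1 := Sym2.card_image_offDiag (G.neighborFinset v)
  rw [G.card_neighborFinset_eq_degree, hv'] at h1
  rw [← h1]
  refine Finset.card_bij (fun x _ => x.2) ?_ ?_ ?_
  · rintro ⟨u, p⟩ hx
    simp only [Finset.mem_filter, mem_wedgesAt, SimpleGraph.wedgeSet, Set.mem_ofPred_eq] at hx
    obtain ⟨⟨⟨hx1, hx2⟩, hx3⟩, rfl⟩ := hx
    induction p using Sym2.ind with
    | _ a b =>
      refine Finset.mem_image.2 ⟨(a, b), ?_, rfl⟩
      simp only [Finset.mem_offDiag, SimpleGraph.mem_neighborFinset]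
      exact ⟨hx2 a (by simp), hx2 b (by simp), by simpa using hx1⟩
  · rintro ⟨u, p⟩ hx ⟨u', p'⟩ hx' h
    simp only [Finset.mem_filter] at hx hx'
    ext1
    · exact hx.2.trans hx'.2.symm
    · exact h
  · intro p hp
    obtain ⟨⟨a, b⟩, hab, rfl⟩ := Finset.mem_image.1 hp
    simp only [Finset.mem_offDiag, SimpleGraph.mem_neighborFinset] at hab
    refine ⟨(v, s(a, b)), ?_, rfl⟩
    simp only [Finset.mem_filter, mem_wedgesAt, SimpleGraph.wedgeSet, Set.mem_ofPred_eq]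
    refine ⟨⟨⟨by simpa using hab.2.2, ?_⟩, hv'⟩, by trivial⟩
    intro u hu
    rcases Sym2.mem_iff.1 hu with rfl | rfl
    · exact hab.1
    · exact hab.2.1

lemma Yfun_mem {V : Type*} [Fintype V] [DecidableEq V] (G : SimpleGraph V)
    [DecidableRel G.Adj] (d : ℕ) (x : V × Sym2 V) : Yfun G d x ∈ Set.Icc (0 : ℝ) 1 := by
  unfold Yfun
  split_ifs <;> norm_num

lemma sum_Yfun {V : Type*} [Fintype V] [DecidableEq V] (G : SimpleGraph V)
    [DecidableRel G.Adj] (d : ℕ) :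
    ∑ x ∈ wedgesAt G d, Yfun G d x =
      (((G.cliqueFinset 3).filter (fun t => ∃ v ∈ t, G.degree v = d)).card : ℝ) := by
  set T := (G.cliqueFinset 3).filter (fun t => ∃ v ∈ t, G.degree v = d) with hT
  set C := (wedgesAt G d).filter (fun x => G.WedgeClosed x) with hC
  have hmemC : ∀ x, x ∈ C ↔ ((¬ x.2.IsDiag ∧ ∀ u ∈ x.2, G.Adj x.1 u) ∧ G.degree x.1 = d) ∧
      x.2 ∈ G.edgeSet := by
    intro x
    rw [hC, Finset.mem_filter, mem_wedgesAt]
    rfl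
  have hclique : ∀ x ∈ C, wedgeTri x ∈ T := by
    rintro ⟨v, p⟩ hx
    rw [hmemC] at hx
    obtain ⟨⟨⟨hx1, hx2⟩, hx3⟩, hx4⟩ := hx
    induction p using Sym2.ind with
    | _ a b =>
      simp only [hT, Finset.mem_filter, SimpleGraph.mem_cliqueFinset_iff]
      refine ⟨?_, v, by simp [mem_wedgeTri_iff], hx3⟩
      have : wedgeTri (v, s(a, b)) = {v, a, b} := by
        ext x; simp [mem_wedgeTri_iff]
      rw [this, SimpleGraph.is3Clique_triple_iff]
      exact ⟨hx2 a (by simp), hx2 b (by simp), by simpa using hx4⟩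
  have h1 : ∑ x ∈ wedgesAt G d, Yfun G d x = ∑ x ∈ C, Yfun G d x := by
    rw [hC, Finset.sum_filter]
    refine Finset.sum_congr rfl fun x _ => ?_
    by_cases h : G.WedgeClosed x
    · simp [h]
    · simp [h, Yfun]
  have h2 : ∀ x ∈ C, Yfun G d x =
      (((wedgeTri x).filter (fun y => G.degree y = d)).card : ℝ)⁻¹ := by
    intro x hx
    have hT' := hclique x hx
    simp only [hT, Finset.mem_filter, SimpleGraph.mem_cliqueFinset_iff] at hT'
    have hc : G.WedgeClosed x := (Finset.mem_filter.1 hx).2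
    have hle : ((wedgeTri x).filter (fun y => G.degree y = d)).card ≤ 3 :=
      (Finset.card_filter_le _ _).trans hT'.1.card_eq.le
    have hpos : 0 < ((wedgeTri x).filter (fun y => G.degree y = d)).card := by
      obtain ⟨v, hv, hvd⟩ := hT'.2
      exact Finset.card_pos.2 ⟨v, Finset.mem_filter.2 ⟨hv, hvd⟩⟩
    unfold Yfun
    generalize ((wedgeTri x).filter (fun y => G.degree y = d)).card = j at hle hpos
    interval_cases j <;> simp [hc]
  rw [h1, ← Finset.sum_fiberwise_of_maps_to hclique]
  have h3 : ∀ t ∈ T, ∑ x ∈ C.filter (fun x => wedgeTri x = t), Yfun G d x = 1 := by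
    intro t ht
    have h4 : ∀ x ∈ C.filter (fun x => wedgeTri x = t), Yfun G d x =
        ((t.filter (fun y => G.degree y = d)).card : ℝ)⁻¹ := by
      intro x hx
      obtain ⟨hx1, rfl⟩ := Finset.mem_filter.1 hx
      exact h2 x hx1
    simp only [hT, Finset.mem_filter, SimpleGraph.mem_cliqueFinset_iff] at ht
    obtain ⟨hcl, v0, hv0, hv0d⟩ := ht
    have hpos : 0 < (t.filter (fun y => G.degree y = d)).card :=
      Finset.card_pos.2 ⟨v0, Finset.mem_filter.2 ⟨hv0, hv0d⟩⟩
    have hcard : (C.filter (fun x => wedgeTri x = t)).card =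
        (t.filter (fun y => G.degree y = d)).card := by
      refine Finset.card_bij (fun x _ => x.1) ?_ ?_ ?_
      · intro x hx
        obtain ⟨hx1, rfl⟩ := Finset.mem_filter.1 hx
        have := (mem_wedgesAt G d x).1 (Finset.mem_filter.1 hx1).1
        exact Finset.mem_filter.2 ⟨by simp [mem_wedgeTri_iff], this.2⟩
      · have key : ∀ x ∈ C.filter (fun x => wedgeTri x = t), ∀ y, y ∈ x.2 ↔ y ∈ t ∧ y ≠ x.1 := by
          intro x hx y
          obtain ⟨hx1, rfl⟩ := Finset.mem_filter.1 hx
          have := ((mem_wedgesAt G d x).1 (Finset.mem_filter.1 hx1).1).1.2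
          rw [mem_wedgeTri_iff]
          constructor
          · intro hy
            exact ⟨Or.inr hy, (this y hy).ne'⟩
          · rintro ⟨h | h, h'⟩
            · exact absurd h h'
            · exact h
        intro x hx x' hx' h
        refine Prod.ext h (Sym2.ext fun y => ?_)
        rw [key x hx, key x' hx']
        rw [h]
      · intro v hv
        obtain ⟨hvt, hvd⟩ := Finset.mem_filter.1 hv
        have hc2 : (t.erase v).card = 2 := by
          rw [Finset.card_erase_of_mem hvt, hcl.card_eq]
        obtain ⟨a, b, hab, he⟩ := Finset.card_eq_two.1 hc2
        have ha : a ∈ t.erase v := by simp [he]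
        have hb : b ∈ t.erase v := by simp [he]
        rw [Finset.mem_erase] at ha hb
        have hadj := hcl.isClique
        refine ⟨(v, s(a, b)), ?_, rfl⟩
        rw [Finset.mem_filter, hmemC]
        refine ⟨⟨⟨⟨by simpa using hab, ?_⟩, hvd⟩, ?_⟩, ?_⟩
        · intro u hu
          rcases Sym2.mem_iff.1 hu with rfl | rfl
          · exact hadj hvt ha.2 ha.1.symm
          · exact hadj hvt hb.2 hb.1.symm
        · exact hadj ha.2 hb.2 hab
        · rw [← Finset.insert_erase hvt, he]
          ext x; simp [mem_wedgeTri_iff]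
    rw [Finset.sum_congr rfl h4, Finset.sum_const, hcard, nsmul_eq_mul]
    exact mul_inv_cancel₀ (by exact_mod_cast hpos.ne')
  rw [Finset.sum_congr rfl h3]
  simp

/-- Fix `d ≥ 2`, with `G` having at least one vertex of degree `d`. Let `w 1, …, w k` be
independent wedges, each generated by choosing a vertex uniformly at random from `V_d` and
then a uniformly random unordered pair of its distinct neighbors (so each wedge centered at
a vertex of `V_d` has probability `(1/n_d) · (1/binom(d,2))`). With `Y i` the sampler
value of `w i` and `Ȳ = (1/k) ∑ i, Y i`, if `ε ∈ (0,1)`, `δ ∈ (0,1)`, and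
`k = ⌈0.5 ε⁻² ln (2/δ)⌉`, then `|W_d · Ȳ − T_d| < ε W_d` with probability greater than
`1 − δ`, where `W_d = n_d · binom(d,2)` and `T_d` is the number of triangles containing
at least one degree-`d` vertex. -/
theorem Td_wedge_sampler {V : Type*} [Fintype V] [DecidableEq V]
    (G : SimpleGraph V) [DecidableRel G.Adj]
    (d : ℕ) (hd : 2 ≤ d) (hne : (G.degVerts d).Nonempty)
    {Ω : Type*} [MeasurableSpace Ω] (μ : Measure Ω) [IsProbabilityMeasure μ]
    (ε δ : ℝ) (hε : ε ∈ Set.Ioo (0 : ℝ) 1) (hδ : δ ∈ Set.Ioo (0 : ℝ) 1)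
    (k : ℕ) (hk : k = ⌈0.5 / ε ^ 2 * Real.log (2 / δ)⌉₊)
    (w : Fin k → Ω → V × Sym2 V)
    (hindep : ∀ (I : Finset (Fin k)) (s : Fin k → V × Sym2 V),
        μ (⋂ i ∈ I, w i ⁻¹' {s i}) = ∏ i ∈ I, μ (w i ⁻¹' {s i}))
    (hdist : ∀ i, ∀ x ∈ G.wedgeSet, G.degree x.1 = d →
        μ (w i ⁻¹' {x}) =
          (1 / ((G.degVerts d).card : ℝ≥0∞)) * (1 / (d.choose 2 : ℝ≥0∞)))
    (hsupp : ∀ i, μ (w i ⁻¹' {x ∈ G.wedgeSet | G.degree x.1 = d}ᶜ) = 0) :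
    ENNReal.ofReal (1 - δ) <
      μ {ω | |(((G.degVerts d).card : ℝ) * (d.choose 2 : ℝ)) *
                ((k : ℝ)⁻¹ * ∑ i, Yfun G d (w i ω)) -
              (((G.cliqueFinset 3).filter (fun t => ∃ v ∈ t, G.degree v = d)).card : ℝ)| <
            ε * (((G.degVerts d).card : ℝ) * (d.choose 2 : ℝ))} := by
  have hc0 : 0 < d.choose 2 := Nat.choose_pos hd
  have hcard := card_wedgesAt G d
  have hpos : 0 < (wedgesAt G d).card := by
    rw [hcard]; exact Nat.mul_pos hne.card_pos hc0
  have hW : (((G.degVerts d).card : ℝ) * (d.choose 2 : ℝ)) = ((wedgesAt G d).card : ℝ) := by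
    rw [hcard]; push_cast; rfl
  have hWpos : (0 : ℝ) < ((wedgesAt G d).card : ℝ) := by exact_mod_cast hpos
  have main := uniform_sampler (wedgesAt G d) (Finset.card_pos.1 hpos) (Yfun G d) (Yfun_mem G d)
    μ ε δ hε hδ k hk w (fun s => by simpa using hindep Finset.univ s) ?_ ?_
  · refine lt_of_lt_of_le main (measure_mono ?_)
    intro ω hω
    simp only [Set.mem_ofPred_eq] at hω ⊢
    rw [hW, ← sum_Yfun]
    set m := ∑ x ∈ wedgesAt G d, Yfun G d x
    have : ((wedgesAt G d).card : ℝ) * ((k : ℝ)⁻¹ * ∑ i, Yfun G d (w i ω)) - m =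
        ((wedgesAt G d).card : ℝ) *
          ((k : ℝ)⁻¹ * ∑ i, Yfun G d (w i ω) - m / (wedgesAt G d).card) := by
      rw [mul_sub, mul_div_cancel₀ _ hWpos.ne']
    rw [this, abs_mul, abs_of_pos hWpos, mul_comm ε]
    exact mul_lt_mul_of_pos_left hω hWpos
  · intro i x hx
    rw [mem_wedgesAt] at hx
    rw [hdist i x hx.1 hx.2, hcard]
    push_cast
    rw [ENNReal.mul_inv (by simp) (by simp)]
    simp
  · intro i x hx
    rw [mem_wedgesAt] at hx
    exact measure_mono_null (Set.preimage_mono (by simpa using hx)) (hsupp i)
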